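/- (Key inequality of Lemma 2, equation (6).) Suppose the pairs ⟨X₁, Y₁⟩ and ⟨X₂, Y₂⟩ are independent and identically distributed, where X₁, X₂ are random bits and Y₁, Y₂ are side information. Set h⁻ = H[(fun ω => X₁ ω + X₂ ω) | ⟨Y₁, Y₂⟩], h⁺ = H[X₂ | ⟨(fun ω => X₁ ω + X₂ ω), ⟨Y₁, Y₂⟩⟩], and h = H[X₁ | Y₁]. Then h⁻·(1 − h⁻) + h⁺·(1 − h⁺) ≤ 2·h·(1 − h). -/

import Mathlib

open MeasureTheory ProbabilityTheory

/-- Shannon entropy of a finitely-valued random variable. -/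
noncomputable def entropy {Ω S : Type*} [MeasurableSpace Ω] [Fintype S]
    (μ : Measure Ω) (X : Ω → S) : ℝ :=
  ∑ s : S, Real.negMulLog (μ (X ⁻¹' {s})).toReal

/-- Conditional Shannon entropy `H[X | Z]` of `X` given `Z`:
the average over the values `z` of `Z` of the entropy of `X` under the
conditional measure `μ[|Z ⁻¹' {z}]`. -/
noncomputable def condEntropy {Ω S T : Type*} [MeasurableSpace Ω] [Fintype S] [Fintype T]
    (μ : Measure Ω) (X : Ω → S) (Z : Ω → T) : ℝ :=
  ∑ z : T, (μ (Z ⁻¹' {z})).toReal * entropy (μ[|Z ⁻¹' {z}]) X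

theorem aux_sum {Ω S : Type*} [MeasurableSpace Ω] [Fintype S] [MeasurableSpace S]
    [MeasurableSingletonClass S] (ν : Measure Ω) [IsProbabilityMeasure ν] (X : Ω → S)
    (hX : Measurable X) : ∑ s : S, (ν (X ⁻¹' {s})).toReal = 1 := by
  have := sum_measureReal_preimage_singleton (μ := ν) (f := X) Finset.univ
    (fun y _ => hX (measurableSet_singleton y))
  simpa [Measure.real] using this

theorem aux_chain {Ω S T : Type*} [MeasurableSpace Ω] [Fintype S] [Fintype T]
    [MeasurableSpace S] [MeasurableSingletonClass S]
    [MeasurableSpace T] [MeasurableSingletonClass T]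
    (μ : Measure Ω) [IsProbabilityMeasure μ] (X : Ω → S) (Z : Ω → T)
    (hX : Measurable X) (hZ : Measurable Z) :
    condEntropy μ X Z = entropy μ (fun ω => (X ω, Z ω)) - entropy μ Z := by
  have key : ∀ z : T, ∑ x : S, Real.negMulLog (μ ((fun ω => (X ω, Z ω)) ⁻¹' {(x, z)})).toReal
      = Real.negMulLog (μ (Z ⁻¹' {z})).toReal
        + (μ (Z ⁻¹' {z})).toReal * entropy (μ[|Z ⁻¹' {z}]) X := by
    intro z
    have hz : MeasurableSet (Z ⁻¹' {z}) := hZ (measurableSet_singleton z)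
    have hset : ∀ x : S, (fun ω => (X ω, Z ω)) ⁻¹' {(x, z)} = Z ⁻¹' {z} ∩ X ⁻¹' {x} := by
      intro x; ext ω; simp [and_comm]
    have hp : ∀ x : S, (μ (Z ⁻¹' {z} ∩ X ⁻¹' {x})).toReal
        = (μ (Z ⁻¹' {z})).toReal * ((μ[|Z ⁻¹' {z}]) (X ⁻¹' {x})).toReal := by
      intro x
      rw [← ENNReal.toReal_mul, mul_comm, cond_mul_eq_inter hz]
    simp only [hset, hp, Real.negMulLog_mul, Finset.sum_add_distrib]
    rw [← Finset.sum_mul, ← Finset.mul_sum]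
    unfold entropy
    congr 1
    by_cases h0 : μ (Z ⁻¹' {z}) = 0
    · simp [h0]
    · have := cond_isProbabilityMeasure h0
      rw [aux_sum _ X hX, one_mul]
  unfold condEntropy
  rw [eq_sub_iff_add_eq]
  conv_rhs => unfold entropy
  rw [Fintype.sum_prod_type_right]
  simp only [key, Finset.sum_add_distrib]
  unfold entropy
  ring

theorem aux_equiv {Ω S T : Type*} [MeasurableSpace Ω] [Fintype S] [Fintype T]
    (μ : Measure Ω) (X : Ω → S) (e : S ≃ T) :
    entropy μ (fun ω => e (X ω)) = entropy μ X := by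
  unfold entropy
  rw [← e.sum_comp]
  refine Finset.sum_congr rfl fun s _ => ?_
  congr 3
  ext ω; simp

theorem aux_ident {Ω S : Type*} [MeasurableSpace Ω] [Fintype S]
    [MeasurableSpace S] [MeasurableSingletonClass S]
    (μ : Measure Ω) (X Y : Ω → S) (h : IdentDistrib X Y μ μ) :
    entropy μ X = entropy μ Y := by
  unfold entropy
  refine Finset.sum_congr rfl fun s _ => ?_
  rw [h.measure_mem_eq (measurableSet_singleton s)]

theorem aux_indep {Ω S T : Type*} [MeasurableSpace Ω] [Fintype S] [Fintype T]
    [MeasurableSpace S] [MeasurableSingletonClass S]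
    [MeasurableSpace T] [MeasurableSingletonClass T]
    (μ : Measure Ω) [IsProbabilityMeasure μ] (X : Ω → S) (Z : Ω → T)
    (hX : Measurable X) (hZ : Measurable Z) (h : IndepFun X Z μ) :
    entropy μ (fun ω => (X ω, Z ω)) = entropy μ X + entropy μ Z := by
  have hp : ∀ x z, (μ ((fun ω => (X ω, Z ω)) ⁻¹' {(x, z)})).toReal
      = (μ (X ⁻¹' {x})).toReal * (μ (Z ⁻¹' {z})).toReal := by
    intro x z
    rw [← ENNReal.toReal_mul, ← h.measure_inter_preimage_eq_mul _ _
      (measurableSet_singleton x) (measurableSet_singleton z)]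
    congr 2
    ext ω; simp
  unfold entropy
  rw [Fintype.sum_prod_type]
  simp only [hp, Real.negMulLog_mul, Finset.sum_add_distrib, ← Finset.sum_mul, ← Finset.mul_sum]
  rw [aux_sum μ X hX, aux_sum μ Z hZ]
  ring

/-- The relabelling used in the proof. -/
def auxE (T : Type*) : (ZMod 2 × T) × (ZMod 2 × T) ≃ ZMod 2 × (ZMod 2 × (T × T)) where
  toFun p := (p.2.1, (p.1.1 + p.2.1, (p.1.2, p.2.2)))
  invFun q := ((q.2.1 - q.1, q.2.2.1), (q.1, q.2.2.2))
  left_inv p := by simp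
  right_inv q := by simp

/-- (Key inequality of Lemma 2, equation (6).) For independent and identically
distributed pairs `⟨X₁, Y₁⟩`, `⟨X₂, Y₂⟩`, writing
`h⁻ = H[X₁ + X₂ | ⟨Y₁, Y₂⟩]`, `h⁺ = H[X₂ | ⟨X₁ + X₂, ⟨Y₁, Y₂⟩⟩]` and
`h = H[X₁ | Y₁]`, one has `h⁻(1 - h⁻) + h⁺(1 - h⁺) ≤ 2 h (1 - h)`. -/
theorem key_inequality_lemma2
    {Ω T : Type*} [MeasurableSpace Ω]
    [MeasurableSpace T] [Fintype T] [MeasurableSingletonClass T]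
    (μ : Measure Ω) [IsProbabilityMeasure μ]
    (X₁ X₂ : Ω → ZMod 2) (hX₁ : Measurable X₁) (hX₂ : Measurable X₂)
    (Y₁ Y₂ : Ω → T) (hY₁ : Measurable Y₁) (hY₂ : Measurable Y₂)
    (hindep : IndepFun (fun ω => (X₁ ω, Y₁ ω)) (fun ω => (X₂ ω, Y₂ ω)) μ)
    (hid : IdentDistrib (fun ω => (X₁ ω, Y₁ ω)) (fun ω => (X₂ ω, Y₂ ω)) μ μ)
    (hminus : ℝ) (hplus : ℝ) (h : ℝ)
    (hm : hminus = condEntropy μ (fun ω => X₁ ω + X₂ ω) (fun ω => (Y₁ ω, Y₂ ω)))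
    (hp : hplus = condEntropy μ X₂ (fun ω => (X₁ ω + X₂ ω, (Y₁ ω, Y₂ ω))))
    (hh : h = condEntropy μ X₁ Y₁) :
    hminus * (1 - hminus) + hplus * (1 - hplus) ≤ 2 * (h * (1 - h)) := by
  have hS : Measurable (fun ω => X₁ ω + X₂ ω) := hX₁.add hX₂
  have hY : Measurable (fun ω => (Y₁ ω, Y₂ ω)) := hY₁.prodMk hY₂
  rw [aux_chain μ _ _ hS hY] at hm
  rw [aux_chain μ _ _ hX₂ (hS.prodMk hY)] at hp
  rw [aux_chain μ _ _ hX₁ hY₁] at hh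
  have h1 : entropy μ (fun ω => (X₂ ω, (X₁ ω + X₂ ω, (Y₁ ω, Y₂ ω))))
      = entropy μ (fun ω => ((X₁ ω, Y₁ ω), (X₂ ω, Y₂ ω))) :=
    aux_equiv μ (fun ω => ((X₁ ω, Y₁ ω), (X₂ ω, Y₂ ω))) (auxE T)
  have h2 := aux_indep μ _ _ (hX₁.prodMk hY₁) (hX₂.prodMk hY₂) hindep
  have h3 := aux_ident μ _ _ hid
  have h4 := aux_indep μ Y₁ Y₂ hY₁ hY₂ (hindep.comp measurable_snd measurable_snd)
  have h5 := aux_ident μ Y₁ Y₂ (hid.comp measurable_snd)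
  have hsum : hminus + hplus = 2 * h := by linarith
  have : h = (hminus + hplus) / 2 := by linarith
  subst this
  nlinarith [sq_nonneg (hminus - hplus)]
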